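/- arXiv:1705.08680 — 2 statements merged into one kernel-verified Lean document; each statement's English description precedes it below -/
import Mathlib

section
/- Let A be a unital C*-algebra. The closed unit ball of A equals the closed convex hull of the set of unitaries of A. -/
open Filter Topology

section RussoDye

variable {A : Type*}

lemma CStarRing.norm_le_one_of_mem_unitary [NormedRing A] [StarRing A] [CStarRing A] {u : A}
    (hu : u ∈ unitary A) : ‖u‖ ≤ 1 := by
  nontriviality A
  exact (CStarRing.norm_of_mem_unitary hu).le

variable [CStarAlgebra A]

/-- Polar decomposition of an invertible element of a C⋆-algebra. -/
lemma IsUnit.exists_eq_unitary_mul_isSelfAdjoint {y : A} (hy : IsUnit y) :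
    ∃ v ∈ unitary A, ∃ a : A, IsSelfAdjoint a ∧ ‖a‖ = ‖y‖ ∧ y = v * a := by
  let _ := CStarAlgebra.spectralOrder A
  let _ := CStarAlgebra.spectralOrderedRing A
  have ha : IsSelfAdjoint (CFC.abs y) := (CFC.abs_nonneg y).isSelfAdjoint
  obtain ⟨b, hb⟩ : IsUnit (CFC.abs y) :=
    (CFC.isUnit_sqrt_iff (star y * y) (star_mul_self_nonneg y)).2 (hy.star.mul hy)
  have hb_star : star (↑b⁻¹ : A) = ↑b⁻¹ := by
    rw [← Units.coe_star, star_inv, show star b = b from Units.ext (by simpa [hb] using ha.star_eq)]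
  refine ⟨y * ↑b⁻¹, ?_, CFC.abs y, ha, CFC.norm_abs, by simp [← hb, mul_assoc]⟩
  have h : star (y * ↑b⁻¹) * (y * ↑b⁻¹) = 1 := by
    rw [star_mul, hb_star, mul_assoc, ← mul_assoc (star y), ← CFC.abs_mul_abs, ← hb]
    simp [mul_assoc]
  exact (hy.mul b⁻¹.isUnit).mem_unitary_of_star_mul_self h

/-- An invertible element of the closed unit ball is the average of two unitaries. -/
lemma IsUnit.mem_convexHull_unitary {y : A} (hy : IsUnit y) (hy_norm : ‖y‖ ≤ 1) :
    y ∈ convexHull ℝ (unitary A : Set A) := by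
  let _ := CStarAlgebra.spectralOrder A
  let _ := CStarAlgebra.spectralOrderedRing A
  obtain ⟨v, hv, a, ha, ha_norm, rfl⟩ := hy.exists_eq_unitary_mul_isSelfAdjoint
  have hw := ha.self_add_I_smul_cfcSqrt_sub_sq_mem_unitary a (ha_norm.trans_le hy_norm)
  set w := a + Complex.I • CFC.sqrt (1 - a ^ 2) with hw_def
  have hstar : star w = a - Complex.I • CFC.sqrt (1 - a ^ 2) := by
    simp [hw_def, ha.star_eq, ← sub_eq_add_neg,
      (CFC.sqrt_nonneg (1 - a ^ 2 : A)).isSelfAdjoint.star_eq]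
  have hmid : midpoint ℝ (v * w) (v * star w) = v * a := by
    rw [midpoint_eq_smul_add, ← mul_add, hstar, hw_def, add_add_sub_cancel, ← two_smul ℝ a,
      mul_smul_comm, smul_smul]
    simp
  rw [← hmid]
  exact (convex_convexHull ℝ _).midpoint_mem (subset_convexHull ℝ _ (mul_mem hv hw))
    (subset_convexHull ℝ _ (mul_mem hv (Unitary.star_mem hw)))

lemma midpoint_mem_convexHull_unitary {x u : A} (hx : ‖x‖ < 1) (hu : u ∈ unitary A) :
    midpoint ℝ x u ∈ convexHull ℝ (unitary A : Set A) := by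
  rw [midpoint_eq_smul_add]
  have hunit : IsUnit (x + u) := by
    have h : ‖-(star u * x)‖ < 1 := by
      rwa [norm_neg, CStarRing.norm_mem_unitary_mul _ (Unitary.star_mem hu)]
    have := (Unitary.toUnits ⟨u, hu⟩).isUnit.mul (isUnit_one_sub_of_norm_lt_one h)
    simpa [mul_add, ← mul_assoc, Unitary.mul_star_self_of_mem hu, add_comm] using this
  refine IsUnit.mem_convexHull_unitary (hunit.smul (Units.mk0 (⅟2 : ℝ) (by norm_num))) ?_
  rw [norm_smul]
  have := norm_add_le x u
  have := CStarRing.norm_le_one_of_mem_unitary hu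
  norm_num
  linarith

lemma mem_closure_convexHull_unitary_of_norm_lt_one {x : A} (hx : ‖x‖ < 1) :
    x ∈ closure (convexHull ℝ (unitary A : Set A)) := by
  have hmid : ∀ y ∈ convexHull ℝ (unitary A : Set A),
      midpoint ℝ x y ∈ convexHull ℝ (unitary A : Set A) := by
    have hconv := (convex_convexHull ℝ (unitary A : Set A)).affine_preimage
      (AffineMap.homothety x (⅟2 : ℝ))
    intro y hy
    exact convexHull_min (fun u hu ↦ midpoint_mem_convexHull_unitary hx hu) hconv hy
  have hiter (n : ℕ) : x + (2⁻¹ : ℝ) ^ n • (1 - x) ∈ convexHull ℝ (unitary A : Set A) := by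
    induction n with
    | zero => simpa using subset_convexHull ℝ _ (one_mem (unitary A))
    | succ n ih =>
      convert hmid _ ih using 1
      rw [midpoint_eq_smul_add, invOf_eq_inv, pow_succ]
      module
  refine mem_closure_of_tendsto ?_ (Eventually.of_forall hiter : ∀ᶠ n in atTop, _)
  have h := tendsto_pow_atTop_nhds_zero_of_lt_one (r := (2⁻¹ : ℝ)) (by norm_num) (by norm_num)
  simpa using (h.smul_const (1 - x)).const_add x

lemma closedBall_eq_closure_convexHull_unitary :
    Metric.closedBall (0 : A) 1 = closure (convexHull ℝ (unitary A : Set A)) := by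
  apply subset_antisymm
  · rw [← closure_ball (0 : A) one_ne_zero]
    refine closure_minimal (fun x hx ↦ ?_) isClosed_closure
    exact mem_closure_convexHull_unitary_of_norm_lt_one (mem_ball_zero_iff.1 hx)
  · refine closure_minimal (convexHull_min (fun u hu ↦ ?_) (convex_closedBall 0 1))
      Metric.isClosed_closedBall
    exact mem_closedBall_zero_iff.2 (CStarRing.norm_le_one_of_mem_unitary hu)

end RussoDye

/-- Russo–Dye theorem: in a unital C*-algebra the closed unit ball is the
closed convex hull of the unitary group. -/
theorem stmt3 {A : Type*} [NormedRing A] [StarRing A] [CStarRing A]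
    [NormedAlgebra ℂ A] [CompleteSpace A] [StarModule ℂ A] :
    Metric.closedBall (0 : A) 1 = closure (convexHull ℝ ((unitary A : Set A))) := by
  let _ : CStarAlgebra A := {}
  exact closedBall_eq_closure_convexHull_unitary
end

section
/- Let A be a C*-algebra, E ⊂ A a closed subspace, and α : E → B a completely bounded map into a C*-algebra B with ‖α‖_cb ≤ C. If B ⊂ B(H), then α extends to a completely bounded map β : A → B(H) with ‖β‖_cb ≤ C. -/
/-- The operator on `ℓ²(Fin k; W)` associated to a `k × k` matrix of bounded
operators on a Hilbert space `W`. -/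
noncomputable def matOp {W : Type*} [NormedAddCommGroup W] [InnerProductSpace ℂ W]
    (k : ℕ) (M : Fin k → Fin k → (W →L[ℂ] W)) :
    PiLp 2 (fun _ : Fin k => W) →L[ℂ] PiLp 2 (fun _ : Fin k => W) :=
  ∑ i : Fin k, ∑ j : Fin k,
    ((PiLp.continuousLinearEquiv 2 ℂ (fun _ : Fin k => W)).symm.toContinuousLinearMap.comp
      ((ContinuousLinearMap.pi (Pi.single i (ContinuousLinearMap.id ℂ W))).comp
        ((M i j).comp
          ((ContinuousLinearMap.proj j).comp
            (PiLp.continuousLinearEquiv 2 ℂ (fun _ : Fin k => W)).toContinuousLinearMap))))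

open scoped TensorProduct InnerProductSpace

/-- A matrix of operators is bounded by `c` as an operator between the Hilbertian direct sums. -/
def MatBound {ι K : Type*} [Fintype ι] [NormedAddCommGroup K] [InnerProductSpace ℂ K]
    (c : ℝ) (x : ι → ι → (K →L[ℂ] K)) : Prop :=
  ∀ v : ι → K, ∑ i, ‖∑ j, x i j (v j)‖ ^ 2 ≤ c ^ 2 * ∑ j, ‖v j‖ ^ 2

section MatBound

variable {K : Type*} [NormedAddCommGroup K] [InnerProductSpace ℂ K]

lemma matOp_apply (k : ℕ) (M : Fin k → Fin k → (K →L[ℂ] K))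
    (v : PiLp 2 (fun _ : Fin k => K)) (i : Fin k) :
    matOp k M v i = ∑ j, M i j (v j) := by
  simp only [matOp, sum_apply, ContinuousLinearMap.comp_apply, WithLp.ofLp_sum, Finset.sum_apply]
  rw [Finset.sum_eq_single i]
  · simp
  · intro b _ hb
    refine Finset.sum_eq_zero fun j _ => ?_
    change (Pi.single b (ContinuousLinearMap.id ℂ K) :
      ∀ _ : Fin k, K →L[ℂ] K) i (M b j (v j)) = 0
    rw [Pi.single_eq_of_ne hb.symm, zero_apply]
  · simp

lemma norm_matOp_le_iff {k : ℕ} {M : Fin k → Fin k → (K →L[ℂ] K)} {c : ℝ} (hc : 0 ≤ c) :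
    ‖matOp k M‖ ≤ c ↔ MatBound c M := by
  rw [ContinuousLinearMap.opNorm_le_iff hc]
  have key : ∀ v : PiLp 2 (fun _ : Fin k => K), ‖matOp k M v‖ ≤ c * ‖v‖ ↔
      ∑ i, ‖∑ j, M i j (v j)‖ ^ 2 ≤ c ^ 2 * ∑ j, ‖v j‖ ^ 2 := by
    intro v
    rw [← sq_le_sq₀ (norm_nonneg _) (by positivity), mul_pow, PiLp.norm_sq_eq_of_L2,
      PiLp.norm_sq_eq_of_L2]
    simp only [matOp_apply]
  exact ⟨fun h v => (key (WithLp.toLp 2 v)).1 (h _), fun h v => (key v).2 (h _)⟩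

lemma MatBound.const_fin_one (x : K →L[ℂ] K) :
    MatBound ‖x‖ (fun _ _ : Fin 1 => x) := by
  intro v
  simpa [← mul_pow] using pow_le_pow_left₀ (norm_nonneg _) (x.le_opNorm (v 0)) 2

lemma MatBound.smul {ι : Type*} [Fintype ι] {c : ℝ} {x : ι → ι → (K →L[ℂ] K)}
    (hx : MatBound c x) (a : ℝ) :
    MatBound (a * c) (fun i j => (a : ℂ) • x i j) := by
  intro v
  simp only [smul_apply, ← Finset.smul_sum, norm_smul, mul_pow,
    ← Finset.mul_sum, Complex.norm_real, Real.norm_eq_abs, sq_abs]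
  rw [mul_assoc]
  exact mul_le_mul_of_nonneg_left (hx v) (sq_nonneg a)

lemma MatBound.mono {ι : Type*} [Fintype ι] {c d : ℝ} {x : ι → ι → (K →L[ℂ] K)}
    (hx : MatBound c x) (hc : 0 ≤ c) (hcd : c ≤ d) : MatBound d x := fun v =>
  (hx v).trans (by gcongr)

end MatBound

section Projection

lemma exists_projection_matrix {k : ℕ} (S : Submodule ℂ (Fin k → ℂ)) :
    ∃ Q : Matrix (Fin k) (Fin k) ℂ, Q.IsHermitian ∧ Q * Q = Q ∧
      (∀ s ∈ S, ∀ i, ∑ j, Q i j * s j = s i) ∧ ∀ j, (fun i => Q i j) ∈ S := by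
  let e := WithLp.linearEquiv 2 ℂ (Fin k → ℂ)
  let S' : Submodule ℂ (EuclideanSpace ℂ (Fin k)) := S.comap e.toLinearMap
  let p := S'.starProjection
  let b := EuclideanSpace.basisFun (Fin k) ℂ
  let Q : Matrix (Fin k) (Fin k) ℂ := fun i j => p (b j) i
  have happ : ∀ (s : EuclideanSpace ℂ (Fin k)) i, ∑ j, Q i j * s j = p s i := by
    intro s i
    have h : s = ∑ j, s j • b j := by
      simpa [b] using (b.sum_repr s).symm
    conv_rhs => rw [h]
    simp [Q, map_sum, mul_comm]
  have hmem : ∀ s, p s ∈ S' := fun s => S'.starProjection_apply_mem s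
  refine ⟨Q, ?_, ?_, ?_, ?_⟩
  · ext i j
    have h1 : ⟪p (b i), b j⟫_ℂ = ⟪b i, p (b j)⟫_ℂ :=
      S'.inner_starProjection_left_eq_right _ _
    rw [Matrix.conjTranspose_apply]
    simpa [b, Q, EuclideanSpace.inner_single_left, EuclideanSpace.inner_single_right] using h1
  · ext i j
    rw [Matrix.mul_apply]
    have := happ (p (b j)) i
    rw [Submodule.starProjection_eq_self_iff.2 (hmem _)] at this
    exact this
  · intro s hs i
    have h := happ (WithLp.toLp 2 s) i
    rw [Submodule.starProjection_eq_self_iff.2 (show WithLp.toLp 2 s ∈ S' from hs)] at h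
    exact h
  · intro j
    exact hmem (b j)

lemma sum_norm_sq_projection_le {ι V : Type*} [Fintype ι] [NormedAddCommGroup V]
    [InnerProductSpace ℂ V] {Q : Matrix ι ι ℂ} (hQ : Q.IsHermitian) (hQQ : Q * Q = Q)
    (v : ι → V) : ∑ i, ‖∑ j, Q i j • v j‖ ^ 2 ≤ ∑ j, ‖v j‖ ^ 2 := by
  set w : ι → V := fun i => ∑ j, Q i j • v j with hw
  have hww : ∀ j, ∑ i, Q j i • w i = w j := by
    intro j
    simp only [hw, Finset.smul_sum, smul_smul]
    rw [Finset.sum_comm]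
    simp only [← Finset.sum_smul]
    refine Finset.sum_congr rfl fun l _ => ?_
    rw [← Matrix.mul_apply, hQQ]
  have h1 : ∑ i, ⟪w i, w i⟫_ℂ = ∑ i, ⟪v i, w i⟫_ℂ := by
    calc ∑ i, ⟪w i, w i⟫_ℂ = ∑ i, ∑ j, Q j i * ⟪v j, w i⟫_ℂ := by
          refine Finset.sum_congr rfl fun i _ => ?_
          conv_lhs => rw [show w i = ∑ j, Q i j • v j from rfl]
          rw [sum_inner]
          refine Finset.sum_congr rfl fun j _ => ?_
          rw [inner_smul_left]
          congr 1
          exact hQ.apply j i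
      _ = ∑ j, ⟪v j, w j⟫_ℂ := by
          rw [Finset.sum_comm]
          refine Finset.sum_congr rfl fun j _ => ?_
          conv_rhs => rw [← hww j]
          simp only [inner_sum, inner_smul_right]
  have h2 : ∑ i, ‖w i‖ ^ 2 = ∑ i, (⟪v i, w i⟫_ℂ).re := by
    have := congrArg Complex.re h1
    simp only [Complex.re_sum] at this
    rw [← this]
    exact Finset.sum_congr rfl fun i _ => norm_sq_eq_re_inner (𝕜 := ℂ) (w i)
  have h3 : 0 ≤ ∑ i, ‖v i - w i‖ ^ 2 := Finset.sum_nonneg fun i _ => sq_nonneg _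
  have h4 : ∑ i, ‖v i - w i‖ ^ 2 =
      ∑ i, ‖v i‖ ^ 2 - 2 * ∑ i, (⟪v i, w i⟫_ℂ).re + ∑ i, ‖w i‖ ^ 2 := by
    rw [Finset.mul_sum, ← Finset.sum_sub_distrib, ← Finset.sum_add_distrib]
    exact Finset.sum_congr rfl fun i _ => norm_sub_sq (𝕜 := ℂ) (v i) (w i)
  linarith

lemma MatBound.compress {ι K : Type*} [Fintype ι] [NormedAddCommGroup K] [InnerProductSpace ℂ K]
    {c : ℝ} {x : ι → ι → (K →L[ℂ] K)} (hx : MatBound c x) {P R : Matrix ι ι ℂ}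
    (hP : P.IsHermitian) (hPP : P * P = P) (hR : R.IsHermitian) (hRR : R * R = R) :
    MatBound c (fun i j => ∑ p, ∑ q, (P i p * R q j) • x p q) := by
  intro v
  have h : ∀ i, ∑ j, (∑ p, ∑ q, (P i p * R q j) • x p q) (v j) =
      ∑ p, P i p • ∑ q, x p q (∑ j, R q j • v j) := by
    intro i
    simp only [sum_apply, smul_apply, map_sum, map_smul,
      Finset.smul_sum, smul_smul]
    rw [Finset.sum_comm]
    exact Finset.sum_congr rfl fun p _ => Finset.sum_comm
  simp only [h]
  calc _ ≤ _ := sum_norm_sq_projection_le hP hPP _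
    _ ≤ _ := hx _
    _ ≤ _ := mul_le_mul_of_nonneg_left (sum_norm_sq_projection_le hR hRR v) (sq_nonneg c)

end Projection

section Tensor

variable {K H : Type*} [NormedAddCommGroup K] [InnerProductSpace ℂ K]
  [NormedAddCommGroup H] [InnerProductSpace ℂ H]

/-- The tensor `∑ i j, f i ⊗ η j ⊗ x i j` attached to a row, a column and a square matrix. -/
noncomputable def matTensor {ι : Type*} [Fintype ι] (f : ι → StrongDual ℂ H) (η : ι → H)
    (x : ι → ι → (K →L[ℂ] K)) : (StrongDual ℂ H ⊗[ℂ] H) ⊗[ℂ] (K →L[ℂ] K) :=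
  ∑ i, ∑ j, (f i ⊗ₜ[ℂ] η j) ⊗ₜ[ℂ] x i j

lemma matTensor_smul {ι : Type*} [Fintype ι] (f : ι → StrongDual ℂ H) (η : ι → H)
    (x : ι → ι → (K →L[ℂ] K)) (a b c : ℂ) :
    matTensor (fun i => a • f i) (fun i => b • η i) (fun i j => c • x i j) =
      (a * b * c) • matTensor f η x := by
  unfold matTensor
  rw [Finset.smul_sum]
  refine Finset.sum_congr rfl fun i _ => ?_
  rw [Finset.smul_sum]
  refine Finset.sum_congr rfl fun j _ => ?_
  rw [TensorProduct.tmul_smul, TensorProduct.tmul_smul, ← TensorProduct.smul_tmul' a,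
    smul_smul, ← TensorProduct.smul_tmul', smul_smul]
  congr 1
  ring

lemma matTensor_compress {ι : Type*} [Fintype ι] (f : ι → StrongDual ℂ H) (η : ι → H)
    (x : ι → ι → (K →L[ℂ] K)) {P R : Matrix ι ι ℂ}
    (hf : ∀ p, ∑ i, P i p • f i = f p) (hη : ∀ q, ∑ j, R q j • η j = η q) :
    matTensor f η (fun i j => ∑ p, ∑ q, (P i p * R q j) • x p q) = matTensor f η x := by
  have h : matTensor f η x =
      ∑ p, ∑ q, ((∑ i, P i p • f i) ⊗ₜ[ℂ] (∑ j, R q j • η j)) ⊗ₜ[ℂ] x p q := by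
    simp only [hf, hη, matTensor]
  rw [h]
  simp only [matTensor, TensorProduct.sum_tmul, TensorProduct.tmul_sum, TensorProduct.tmul_smul,
    TensorProduct.smul_tmul', smul_smul, Finset.smul_sum]
  calc _ = ∑ i, ∑ p, ∑ q, ∑ j, (P i p * R q j) • ((f i ⊗ₜ[ℂ] η j) ⊗ₜ[ℂ] x p q) := by
        refine Finset.sum_congr rfl fun i _ => ?_
        rw [Finset.sum_comm]
        exact Finset.sum_congr rfl fun p _ => Finset.sum_comm
    _ = ∑ p, ∑ q, ∑ i, ∑ j, (P i p * R q j) • ((f i ⊗ₜ[ℂ] η j) ⊗ₜ[ℂ] x p q) := by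
        rw [Finset.sum_comm]
        exact Finset.sum_congr rfl fun p _ => Finset.sum_comm
    _ = _ := by
        refine Finset.sum_congr rfl fun p _ => Finset.sum_congr rfl fun q _ => ?_
        rw [Finset.sum_comm]
        simp only [TensorProduct.smul_tmul', mul_comm]

/-- The slice map `f ⊗ η ⊗ x ↦ (f v * g η) • x`. -/
noncomputable def tensorSlice (v : H) (g : StrongDual ℂ H) :
    (StrongDual ℂ H ⊗[ℂ] H) ⊗[ℂ] (K →L[ℂ] K) →ₗ[ℂ] (K →L[ℂ] K) :=
  TensorProduct.lift ((LinearMap.lsmul ℂ (K →L[ℂ] K)).comp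
    (TensorProduct.lift (LinearMap.mk₂ ℂ (fun (f : StrongDual ℂ H) (η : H) => f v * g η)
      (by intros; simp [add_mul]) (by intros; simp [mul_assoc])
      (by intros; simp [mul_add]) (by intros; simp [mul_left_comm]))))

@[simp] lemma tensorSlice_tmul (v : H) (g f : StrongDual ℂ H) (η : H) (x : K →L[ℂ] K) :
    tensorSlice v g ((f ⊗ₜ[ℂ] η) ⊗ₜ[ℂ] x) = (f v * g η) • x := by
  simp [tensorSlice]

lemma tensorSlice_mem (E : Submodule ℂ (K →L[ℂ] K)) (v : H) (g : StrongDual ℂ H)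
    {u : (StrongDual ℂ H ⊗[ℂ] H) ⊗[ℂ] (K →L[ℂ] K)}
    (hu : u ∈ LinearMap.range (E.subtype.lTensor (StrongDual ℂ H ⊗[ℂ] H))) :
    tensorSlice v g u ∈ E := by
  obtain ⟨t, rfl⟩ := hu
  induction t with
  | zero => simp
  | add a b ha hb => simpa only [map_add] using E.add_mem ha hb
  | tmul w e =>
    simp only [LinearMap.lTensor_tmul, tensorSlice, TensorProduct.lift.tmul, Submodule.subtype_apply]
    exact E.smul_mem _ e.2

/-- A matrix over `E` can be chosen to represent a tensor over `E`, without increasing the bound. -/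
lemma exists_matTensor_eq_of_mem_range (E : Submodule ℂ (K →L[ℂ] K)) {k : ℕ} {c : ℝ}
    (f : Fin k → StrongDual ℂ H) (η : Fin k → H) (x : Fin k → Fin k → (K →L[ℂ] K))
    (hx : MatBound c x)
    (hu : matTensor f η x ∈ LinearMap.range (E.subtype.lTensor (StrongDual ℂ H ⊗[ℂ] H))) :
    ∃ y : Fin k → Fin k → E, MatBound c (fun i j => (y i j : K →L[ℂ] K)) ∧
      matTensor f η x = matTensor f η (fun i j => (y i j : K →L[ℂ] K)) := by
  let S : Submodule ℂ (Fin k → ℂ) :=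
    LinearMap.range (LinearMap.pi fun i => (f i).toLinearMap)
  let S' : Submodule ℂ (Fin k → ℂ) :=
    LinearMap.range (LinearMap.pi fun j => (ContinuousLinearMap.apply ℂ ℂ (η j)).toLinearMap)
  obtain ⟨Q, hQ, hQQ, hQS, hQm⟩ := exists_projection_matrix S
  obtain ⟨R, hR, hRR, hRS, hRm⟩ := exists_projection_matrix S'
  have hf : ∀ p, ∑ i, Q.transpose i p • f i = f p := by
    intro p
    ext v
    simpa [Matrix.transpose_apply] using hQS (fun i => f i v) ⟨v, rfl⟩ p
  have hη : ∀ q, ∑ j, R q j • η j = η q := by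
    intro q
    refine ext_inner_left ℂ fun v => ?_
    simpa [inner_sum, inner_smul_right] using
      hRS (fun j => innerSL ℂ v (η j)) ⟨innerSL ℂ v, rfl⟩ q
  have hmem : ∀ i j, ∑ p, ∑ q, (Q.transpose i p * R q j) • x p q ∈ E := by
    intro i j
    obtain ⟨v, hv⟩ := hQm i
    obtain ⟨g, hg⟩ := hRm j
    have h := tensorSlice_mem E v g hu
    convert h using 1
    simp only [matTensor, map_sum, tensorSlice_tmul]
    refine Finset.sum_congr rfl fun p _ => Finset.sum_congr rfl fun q _ => ?_
    rw [Matrix.transpose_apply, ← congrFun hv p, ← congrFun hg q]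
    rfl
  refine ⟨fun i j => ⟨_, hmem i j⟩, hx.compress hQ.transpose ?_ hR hRR,
    (matTensor_compress f η x hf hη).symm⟩
  rw [← Matrix.transpose_mul, hQQ]

/-- The functional `f ⊗ η ⊗ x ↦ f (α x η)`. -/
noncomputable def tensorFunctional (α : (K →L[ℂ] K) →ₗ[ℂ] (H →L[ℂ] H)) :
    (StrongDual ℂ H ⊗[ℂ] H) ⊗[ℂ] (K →L[ℂ] K) →ₗ[ℂ] ℂ :=
  TensorProduct.lift (TensorProduct.lift (LinearMap.mk₂ ℂ
    (fun (f : StrongDual ℂ H) (η : H) =>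
      f.toLinearMap ∘ₗ (ContinuousLinearMap.apply ℂ H η).toLinearMap ∘ₗ α)
    (by intros; ext; simp) (by intros; ext; simp)
    (by intros; ext; simp) (by intros; ext; simp)))

lemma tensorFunctional_tmul (α : (K →L[ℂ] K) →ₗ[ℂ] (H →L[ℂ] H)) (f : StrongDual ℂ H)
    (η : H) (x : K →L[ℂ] K) :
    tensorFunctional α ((f ⊗ₜ[ℂ] η) ⊗ₜ[ℂ] x) = f (α x η) := by
  simp [tensorFunctional]

lemma tensorFunctional_matTensor {ι : Type*} [Fintype ι]
    (α : (K →L[ℂ] K) →ₗ[ℂ] (H →L[ℂ] H)) (f : ι → StrongDual ℂ H) (η : ι → H)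
    (x : ι → ι → (K →L[ℂ] K)) :
    tensorFunctional α (matTensor f η x) = ∑ i, f i (∑ j, α (x i j) (η j)) := by
  simp [matTensor, tensorFunctional_tmul]

lemma norm_sum_apply_le {ι : Type*} [Fintype ι] (f : ι → StrongDual ℂ H) (z : ι → H) :
    ‖∑ i, f i (z i)‖ ≤ √(∑ i, ‖f i‖ ^ 2) * √(∑ i, ‖z i‖ ^ 2) :=
  calc _ ≤ ∑ i, ‖f i‖ * ‖z i‖ := norm_sum_le_of_le _ fun i _ => (f i).le_opNorm (z i)
    _ ≤ _ := Real.sum_mul_le_sqrt_mul_sqrt _ _ _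

/-- The costs of the representations of a tensor by a contractive matrix. -/
def tensorCosts (u : (StrongDual ℂ H ⊗[ℂ] H) ⊗[ℂ] (K →L[ℂ] K)) : Set ℝ :=
  {r | ∃ (k : ℕ) (f : Fin k → StrongDual ℂ H) (η : Fin k → H) (x : Fin k → Fin k → (K →L[ℂ] K)),
    MatBound 1 x ∧ u = matTensor f η x ∧ r = (∑ i, ‖f i‖ ^ 2 + ∑ j, ‖η j‖ ^ 2) / 2}

lemma tensorCosts_nonneg {u : (StrongDual ℂ H ⊗[ℂ] H) ⊗[ℂ] (K →L[ℂ] K)} {r : ℝ}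
    (hr : r ∈ tensorCosts u) : 0 ≤ r := by
  obtain ⟨k, f, η, x, -, -, rfl⟩ := hr
  positivity

lemma bddBelow_tensorCosts (u : (StrongDual ℂ H ⊗[ℂ] H) ⊗[ℂ] (K →L[ℂ] K)) :
    BddBelow (tensorCosts u) := ⟨0, fun _ => tensorCosts_nonneg⟩

lemma tensorCosts_zero :
    (0 : ℝ) ∈ tensorCosts (0 : (StrongDual ℂ H ⊗[ℂ] H) ⊗[ℂ] (K →L[ℂ] K)) :=
  ⟨0, 0, 0, 0, by intro v; simp, by simp [matTensor], by simp⟩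

lemma tensorCosts_add {u w : (StrongDual ℂ H ⊗[ℂ] H) ⊗[ℂ] (K →L[ℂ] K)} {r s : ℝ}
    (hr : r ∈ tensorCosts u) (hs : s ∈ tensorCosts w) : r + s ∈ tensorCosts (u + w) := by
  obtain ⟨m, f, η, x, hx, rfl, rfl⟩ := hr
  obtain ⟨n, g, ζ, y, hy, rfl, rfl⟩ := hs
  refine ⟨m + n, Fin.append f g, Fin.append η ζ,
    Fin.append (fun i => Fin.append (x i) 0) (fun i => Fin.append 0 (y i)), ?_, ?_, ?_⟩
  · intro v
    have h1 := hx (fun i => v (Fin.castAdd n i))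
    have h2 := hy (fun i => v (Fin.natAdd m i))
    simp only [one_pow, one_mul] at h1 h2 ⊢
    simpa [Fin.sum_univ_add] using add_le_add h1 h2
  · simp [matTensor, Fin.sum_univ_add]
  · simp only [Fin.sum_univ_add, Fin.append_left, Fin.append_right]
    ring

lemma mul_mem_tensorCosts {k : ℕ} {f : Fin k → StrongDual ℂ H} {η : Fin k → H}
    {x : Fin k → Fin k → (K →L[ℂ] K)} {r a b : ℝ} (hr : 0 < r) (ha : 0 < a) (hb : 0 < b)
    (hx : MatBound r x) (hf : ∑ i, ‖f i‖ ^ 2 ≤ a ^ 2) (hη : ∑ i, ‖η i‖ ^ 2 ≤ b ^ 2) :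
    ∃ s ∈ tensorCosts (matTensor f η x), s ≤ r * a * b := by
  obtain ⟨ρ, hρ, rfl⟩ : ∃ ρ, 0 < ρ ∧ ρ ^ 2 = r := ⟨√r, by positivity, Real.sq_sqrt hr.le⟩
  obtain ⟨p, hp, rfl⟩ : ∃ p, 0 < p ∧ p ^ 2 = a := ⟨√a, by positivity, Real.sq_sqrt ha.le⟩
  obtain ⟨q, hq, rfl⟩ : ∃ q, 0 < q ∧ q ^ 2 = b := ⟨√b, by positivity, Real.sq_sqrt hb.le⟩
  refine ⟨_, ⟨k, fun i => ((ρ * q / p : ℝ) : ℂ) • f i, fun i => ((ρ * p / q : ℝ) : ℂ) • η i,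
    fun i j => (((ρ ^ 2)⁻¹ : ℝ) : ℂ) • x i j, ?_, ?_, rfl⟩, ?_⟩
  · have h := hx.smul (ρ ^ 2)⁻¹
    rwa [inv_mul_cancel₀ hr.ne'] at h
  · have : (ρ * q / p) * (ρ * p / q) * (ρ ^ 2)⁻¹ = 1 := by field_simp
    rw [matTensor_smul, ← Complex.ofReal_mul, ← Complex.ofReal_mul, this, Complex.ofReal_one,
      one_smul]
  · simp only [norm_smul, mul_pow, ← Finset.mul_sum, Complex.norm_real, Real.norm_eq_abs, sq_abs]
    have h1 : (ρ * q / p) ^ 2 * ∑ i, ‖f i‖ ^ 2 ≤ (ρ * q / p) ^ 2 * (p ^ 2) ^ 2 := by gcongr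
    have h2 : (ρ * p / q) ^ 2 * ∑ i, ‖η i‖ ^ 2 ≤ (ρ * p / q) ^ 2 * (q ^ 2) ^ 2 := by gcongr
    have e1 : (ρ * q / p) ^ 2 * (p ^ 2) ^ 2 = ρ ^ 2 * p ^ 2 * q ^ 2 := by field_simp
    have e2 : (ρ * p / q) ^ 2 * (q ^ 2) ^ 2 = ρ ^ 2 * p ^ 2 * q ^ 2 := by field_simp
    linarith

lemma tensorCosts_nonempty (u : (StrongDual ℂ H ⊗[ℂ] H) ⊗[ℂ] (K →L[ℂ] K)) :
    (tensorCosts u).Nonempty := by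
  induction u with
  | zero => exact ⟨0, tensorCosts_zero⟩
  | add u w hu hw =>
    obtain ⟨r, hr⟩ := hu
    obtain ⟨s, hs⟩ := hw
    exact ⟨_, tensorCosts_add hr hs⟩
  | tmul w x =>
    induction w with
    | zero => exact ⟨0, by simpa using tensorCosts_zero⟩
    | add u w hu hw =>
      obtain ⟨r, hr⟩ := hu
      obtain ⟨s, hs⟩ := hw
      exact ⟨_, by simpa only [TensorProduct.add_tmul] using tensorCosts_add hr hs⟩
    | tmul f η =>
      obtain ⟨s, hs, -⟩ := mul_mem_tensorCosts (f := fun _ : Fin 1 => f) (η := fun _ => η)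
        (r := ‖x‖ + 1) (a := ‖f‖ + 1) (b := ‖η‖ + 1)
        (by positivity) (by positivity) (by positivity)
        ((MatBound.const_fin_one x).mono (norm_nonneg _) (by linarith))
        (by simp only [Fin.sum_univ_one]; gcongr; linarith)
        (by simp only [Fin.sum_univ_one]; gcongr; linarith)
      exact ⟨s, by simpa [matTensor] using hs⟩

lemma tensorCosts_smul {u : (StrongDual ℂ H ⊗[ℂ] H) ⊗[ℂ] (K →L[ℂ] K)} {r : ℝ}
    (hr : r ∈ tensorCosts u) {c : ℂ} (hc : c ≠ 0) : ‖c‖ * r ∈ tensorCosts (c • u) := by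
  obtain ⟨k, f, η, x, hx, rfl, rfl⟩ := hr
  obtain ⟨ρ, hρ, hρc⟩ : ∃ ρ, 0 < ρ ∧ ρ ^ 2 = ‖c‖ :=
    ⟨√‖c‖, Real.sqrt_pos.2 (norm_pos_iff.2 hc), Real.sq_sqrt (norm_nonneg c)⟩
  refine ⟨k, fun i => (c / ρ) • f i, fun i => (ρ : ℂ) • η i, x, hx, ?_, ?_⟩
  · have : c / ρ * ρ * 1 = c := by
      rw [mul_one, div_mul_cancel₀ _ (by exact_mod_cast hρ.ne')]
    simpa only [this, one_smul] using (matTensor_smul f η x (c / ρ) ρ 1).symm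
  · have h : ‖c / ρ‖ ^ 2 = ‖c‖ := by
      rw [norm_div, Complex.norm_real, Real.norm_eq_abs, div_pow, sq_abs, hρc]
      field_simp
    simp only [norm_smul, mul_pow, ← Finset.mul_sum, h, Complex.norm_real, Real.norm_eq_abs,
      sq_abs, hρc]
    ring

/-- Given explicitly because instance search does not find the group structure on this nested
tensor product. -/
noncomputable instance instAddCommGroupTensor :
    AddCommGroup ((StrongDual ℂ H ⊗[ℂ] H) ⊗[ℂ] (K →L[ℂ] K)) :=
  Module.addCommMonoidToAddCommGroup ℂ

/-- The seminorm on the tensor product dual to the completely bounded norm. -/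
noncomputable def tensorSeminorm (K H : Type*) [NormedAddCommGroup K] [InnerProductSpace ℂ K]
    [NormedAddCommGroup H] [InnerProductSpace ℂ H] :
    Seminorm ℂ ((StrongDual ℂ H ⊗[ℂ] H) ⊗[ℂ] (K →L[ℂ] K)) :=
  Seminorm.ofSMulLE (fun u => sInf (tensorCosts u))
    (le_antisymm (csInf_le (bddBelow_tensorCosts _) tensorCosts_zero)
      (le_csInf (tensorCosts_nonempty _) fun _ => tensorCosts_nonneg))
    (fun u w => by
      rw [← csInf_add (tensorCosts_nonempty u) (bddBelow_tensorCosts u)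
        (tensorCosts_nonempty w) (bddBelow_tensorCosts w)]
      refine csInf_le_csInf (bddBelow_tensorCosts _)
        ((tensorCosts_nonempty u).add (tensorCosts_nonempty w)) ?_
      rintro _ ⟨r, hr, s, hs, rfl⟩
      exact tensorCosts_add hr hs)
    (fun c u => by
      rcases eq_or_ne c 0 with rfl | hc
      · simpa using csInf_le (bddBelow_tensorCosts _) tensorCosts_zero
      · rw [← div_le_iff₀' (norm_pos_iff.2 hc)]
        refine le_csInf (tensorCosts_nonempty u) fun r hr => ?_
        rw [div_le_iff₀' (norm_pos_iff.2 hc)]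
        exact csInf_le (bddBelow_tensorCosts _) (tensorCosts_smul hr hc))

lemma tensorSeminorm_matTensor_le {k : ℕ} {f : Fin k → StrongDual ℂ H} {η : Fin k → H}
    {x : Fin k → Fin k → (K →L[ℂ] K)} {r a b : ℝ} (hr : 0 ≤ r) (ha : 0 ≤ a) (hb : 0 ≤ b)
    (hx : MatBound r x) (hf : ∑ i, ‖f i‖ ^ 2 ≤ a ^ 2) (hη : ∑ i, ‖η i‖ ^ 2 ≤ b ^ 2) :
    tensorSeminorm K H (matTensor f η x) ≤ r * a * b := by
  have hlim : Filter.Tendsto (fun ε : ℝ => (r + ε) * (a + ε) * (b + ε))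
      (nhdsWithin 0 (Set.Ioi 0)) (nhds (r * a * b)) := by
    have : Continuous fun ε : ℝ => (r + ε) * (a + ε) * (b + ε) := by fun_prop
    simpa using (this.tendsto 0).mono_left nhdsWithin_le_nhds
  refine ge_of_tendsto hlim (eventually_nhdsWithin_of_forall fun ε hε => ?_)
  have hε : 0 < ε := hε
  obtain ⟨s, hs, hle⟩ := mul_mem_tensorCosts (r := r + ε) (a := a + ε) (b := b + ε)
    (by positivity) (by positivity) (by positivity) (hx.mono hr (by linarith))
    (hf.trans (by gcongr; linarith)) (hη.trans (by gcongr; linarith))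
  exact (csInf_le (bddBelow_tensorCosts _) hs).trans hle

/-- The functional of a map is dominated by the seminorm on tensors over `E` if the map is
completely bounded on `E`. -/
lemma norm_tensorFunctional_le (E : Submodule ℂ (K →L[ℂ] K))
    (α : (K →L[ℂ] K) →ₗ[ℂ] (H →L[ℂ] H)) {C : ℝ} (hC : 0 ≤ C)
    (hα : ∀ (k : ℕ) (y : Fin k → Fin k → E), MatBound 1 (fun i j => (y i j : K →L[ℂ] K)) →
      MatBound C (fun i j => α (y i j)))
    {u : (StrongDual ℂ H ⊗[ℂ] H) ⊗[ℂ] (K →L[ℂ] K)}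
    (hu : u ∈ LinearMap.range (E.subtype.lTensor (StrongDual ℂ H ⊗[ℂ] H))) :
    ‖tensorFunctional α u‖ ≤ C * tensorSeminorm K H u := by
  have h : ∀ r ∈ tensorCosts u, ‖tensorFunctional α u‖ ≤ C * r := by
    rintro _ ⟨k, f, η, x, hx, rfl, rfl⟩
    obtain ⟨y, hy, hxy⟩ := exists_matTensor_eq_of_mem_range E f η x hx hu
    rw [hxy, tensorFunctional_matTensor]
    refine (norm_sum_apply_le f _).trans ?_
    have h1 : √(∑ i, ‖∑ j, α (y i j) (η j)‖ ^ 2) ≤ C * √(∑ j, ‖η j‖ ^ 2) := by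
      rw [← Real.sqrt_sq hC, ← Real.sqrt_mul (sq_nonneg C)]
      exact Real.sqrt_le_sqrt (by simpa [Real.sqrt_sq hC] using hα k y hy η)
    have h2 := Real.sq_sqrt (show 0 ≤ ∑ i, ‖f i‖ ^ 2 by positivity)
    have h3 := Real.sq_sqrt (show 0 ≤ ∑ i, ‖η i‖ ^ 2 by positivity)
    have h4 := two_mul_le_add_sq (√(∑ i, ‖f i‖ ^ 2)) (√(∑ i, ‖η i‖ ^ 2))
    calc _ ≤ √(∑ i, ‖f i‖ ^ 2) * (C * √(∑ j, ‖η j‖ ^ 2)) := by gcongr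
      _ = C * (√(∑ i, ‖f i‖ ^ 2) * √(∑ j, ‖η j‖ ^ 2)) := by ring
      _ ≤ _ := by gcongr; linarith
  rcases hC.eq_or_lt with rfl | hC
  · obtain ⟨r, hr⟩ := tensorCosts_nonempty u
    simpa using h r hr
  · rw [← div_le_iff₀' hC]
    exact le_csInf (tensorCosts_nonempty u) fun r hr => (div_le_iff₀' hC).2 (h r hr)

/-- Every functional dominated by the seminorm comes from a linear map. -/
lemma exists_apply_eq_of_norm_le [CompleteSpace H]
    (φ : (StrongDual ℂ H ⊗[ℂ] H) ⊗[ℂ] (K →L[ℂ] K) →ₗ[ℂ] ℂ) {C : ℝ} (hC : 0 ≤ C)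
    (hφ : ∀ u, ‖φ u‖ ≤ C * tensorSeminorm K H u) :
    ∃ β : (K →L[ℂ] K) →ₗ[ℂ] (H →L[ℂ] H),
      ∀ (f : StrongDual ℂ H) (η : H) (x : K →L[ℂ] K), f (β x η) = φ ((f ⊗ₜ[ℂ] η) ⊗ₜ[ℂ] x) := by
  have hbound : ∀ (f : StrongDual ℂ H) (η : H) (x : K →L[ℂ] K),
      ‖φ ((f ⊗ₜ[ℂ] η) ⊗ₜ[ℂ] x)‖ ≤ (C * ‖x‖) * ‖f‖ * ‖η‖ := by
    intro f η x
    have h := tensorSeminorm_matTensor_le (f := fun _ : Fin 1 => f) (η := fun _ => η)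
      (norm_nonneg x) (norm_nonneg f) (norm_nonneg η) (MatBound.const_fin_one x)
      (by simp) (by simp)
    simp only [matTensor, Fin.sum_univ_one] at h
    calc _ ≤ _ := hφ _
      _ ≤ C * (‖x‖ * ‖f‖ * ‖η‖) := by gcongr
      _ = _ := by ring
  let B : (K →L[ℂ] K) → (H →L⋆[ℂ] H →L[ℂ] ℂ) := fun x =>
    (LinearMap.mk₂'ₛₗ (starRingEnd ℂ) (RingHom.id ℂ)
      (fun ξ η => φ ((InnerProductSpace.toDual ℂ H ξ ⊗ₜ[ℂ] η) ⊗ₜ[ℂ] x))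
      (by intros; simp [TensorProduct.add_tmul])
      (by
        intros
        rw [map_smulₛₗ, ← TensorProduct.smul_tmul', ← TensorProduct.smul_tmul', map_smul])
      (by intros; simp [TensorProduct.add_tmul, TensorProduct.tmul_add])
      (by intros; simp [← TensorProduct.smul_tmul'])).mkContinuous₂ (C * ‖x‖)
      (fun ξ η => by simpa using hbound (InnerProductSpace.toDual ℂ H ξ) η x)
  let β : (K →L[ℂ] K) → (H →L[ℂ] H) := fun x =>
    ContinuousLinearMap.adjoint (InnerProductSpace.continuousLinearMapOfBilin (B x))
  have hβ : ∀ ξ η x, ⟪ξ, β x η⟫_ℂ =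
      φ ((InnerProductSpace.toDual ℂ H ξ ⊗ₜ[ℂ] η) ⊗ₜ[ℂ] x) := by
    intro ξ η x
    simp only [β, ContinuousLinearMap.adjoint_inner_right,
      InnerProductSpace.continuousLinearMapOfBilin_apply, B]
    rfl
  refine ⟨{ toFun := β, map_add' := ?_, map_smul' := ?_ }, ?_⟩
  · intro x y
    ext η
    refine ext_inner_left ℂ fun ξ => ?_
    simp [hβ, inner_add_right, TensorProduct.tmul_add]
  · intro c x
    ext η
    refine ext_inner_left ℂ fun ξ => ?_
    simp [hβ, inner_smul_right]
  · intro f η x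
    obtain ⟨ξ, rfl⟩ := (InnerProductSpace.toDual ℂ H).surjective f
    simpa using hβ ξ η x

/-- A map whose functional is dominated by the seminorm is completely bounded. -/
lemma MatBound.of_tensorFunctional_le (β : (K →L[ℂ] K) →ₗ[ℂ] (H →L[ℂ] H)) {C : ℝ} (hC : 0 ≤ C)
    (hβ : ∀ u, ‖tensorFunctional β u‖ ≤ C * tensorSeminorm K H u) {k : ℕ} {r : ℝ} (hr : 0 ≤ r)
    {x : Fin k → Fin k → (K →L[ℂ] K)} (hx : MatBound r x) :
    MatBound (C * r) (fun i j => β (x i j)) := by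
  intro η
  set z : Fin k → H := fun i => ∑ j, β (x i j) (η j) with hz
  set s := √(∑ i, ‖z i‖ ^ 2) with hs
  set t := √(∑ j, ‖η j‖ ^ 2) with ht
  have hs2 : s ^ 2 = ∑ i, ‖z i‖ ^ 2 := Real.sq_sqrt (by positivity)
  have ht2 : t ^ 2 = ∑ i, ‖η i‖ ^ 2 := Real.sq_sqrt (by positivity)
  have h1 := tensorSeminorm_matTensor_le (f := fun i => innerSL ℂ (z i)) (η := η) (a := s) (b := t)
    hr (Real.sqrt_nonneg _) (Real.sqrt_nonneg _) hx (by simp [hs2]) ht2.ge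
  have h2 : tensorFunctional β (matTensor (fun i => innerSL ℂ (z i)) η x) = ((s ^ 2 : ℝ) : ℂ) := by
    rw [tensorFunctional_matTensor, hs2]
    push_cast
    exact Finset.sum_congr rfl fun i _ => inner_self_eq_norm_sq_to_K (𝕜 := ℂ) (z i)
  have h3 : s ^ 2 ≤ C * (r * s * t) := by
    have := hβ (matTensor (fun i => innerSL ℂ (z i)) η x)
    rw [h2, Complex.norm_real, Real.norm_of_nonneg (sq_nonneg s)] at this
    exact this.trans (by gcongr)
  have h4 : s ≤ C * r * t := by
    rcases (Real.sqrt_nonneg _ : 0 ≤ s).eq_or_lt with h | h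
    · rw [show s = 0 from h.symm]
      positivity
    · exact le_of_mul_le_mul_right (by nlinarith) h
  rw [← hs2, ← ht2, ← mul_pow]
  gcongr

end Tensor

/-- Arveson–Wittstock extension theorem: a completely bounded map `α` defined on
a closed subspace `E ⊆ B(K)` with values in `B(H)`, with `‖α‖_cb ≤ C`, extends
to a completely bounded map `β : B(K) → B(H)` with `‖β‖_cb ≤ C`. -/
theorem stmt11 {K H : Type*}
    [NormedAddCommGroup K] [InnerProductSpace ℂ K] [CompleteSpace K]
    [NormedAddCommGroup H] [InnerProductSpace ℂ H] [CompleteSpace H]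
    (E : Submodule ℂ (K →L[ℂ] K)) (hE : IsClosed (E : Set (K →L[ℂ] K)))
    (α : E →ₗ[ℂ] (H →L[ℂ] H)) (C : ℝ) (hC : 0 ≤ C)
    (hα : ∀ (k : ℕ) (x : Fin k → Fin k → E),
      ‖matOp k (fun i j => α (x i j))‖ ≤
        C * ‖matOp k (fun i j => (x i j : K →L[ℂ] K))‖) :
    ∃ β : (K →L[ℂ] K) →ₗ[ℂ] (H →L[ℂ] H),
      (∀ e : E, β e = α e) ∧
      ∀ (k : ℕ) (x : Fin k → Fin k → (K →L[ℂ] K)),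
        ‖matOp k (fun i j => β (x i j))‖ ≤ C * ‖matOp k x‖ := by
  have hα' : ∀ (k : ℕ) (y : Fin k → Fin k → E) (c : ℝ), 0 ≤ c →
      MatBound c (fun i j => (y i j : K →L[ℂ] K)) → MatBound (C * c) (fun i j => α (y i j)) := by
    intro k y c hc hy
    refine (norm_matOp_le_iff (by positivity)).1 ((hα k y).trans ?_)
    gcongr
    exact (norm_matOp_le_iff hc).2 hy
  obtain ⟨α', hα'E⟩ := α.exists_extend
  have hext : ∀ e : E, α' e = α e := fun e => LinearMap.congr_fun hα'E e
  let D := LinearMap.range (E.subtype.lTensor (StrongDual ℂ H ⊗[ℂ] H))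
  obtain ⟨φ, hφD, hφ⟩ := Module.Dual.exists_extension_of_le_seminorm D
    ((tensorFunctional α').comp D.subtype) (p := (NNReal.mk C hC) • tensorSeminorm K H)
    (fun u : D => norm_tensorFunctional_le E α' hC
      (fun k y hy => by simpa [hext] using hα' k y 1 zero_le_one hy) u.2)
  obtain ⟨β, hβ⟩ := exists_apply_eq_of_norm_le φ hC hφ
  have hβφ : tensorFunctional β = φ := by
    ext f η x
    simp [tensorFunctional_tmul, hβ]
  refine ⟨β, fun e => ?_, fun k x => ?_⟩
  · ext η
    refine ext_inner_left ℂ fun ξ => ?_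
    have h := hφD ⟨(innerSL ℂ ξ ⊗ₜ[ℂ] η) ⊗ₜ[ℂ] (e : K →L[ℂ] K), ⟨_ ⊗ₜ[ℂ] e, rfl⟩⟩
    simpa [tensorFunctional_tmul, hext, ← hβ] using h
  · exact (norm_matOp_le_iff (by positivity)).2
      (MatBound.of_tensorFunctional_le β hC (hβφ ▸ hφ) (norm_nonneg _)
        ((norm_matOp_le_iff (norm_nonneg _)).1 le_rfl))
end
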